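/- Let $H \in (0, 1/2)$ and for $T > 0$ define $I_{11}(T) := \int_{[0,T]^3} e^{t_1 - T - |s - t_2|} \, \mathrm{sgn}(t_2 - s) \, \big( T^{2H-1} - (T-s)^{2H-1} \big) \, \big( t_2^{2H-1} - \mathrm{sgn}(t_2 - t_1)|t_2 - t_1|^{2H-1} \big) \, ds \, dt_1 \, dt_2$. Then $\limsup_{T \to \infty} T^{1-2H} \, \Big| I_{11}(T) - \tfrac{1}{2} \Gamma(2H)^2 \sigma_H^2 \Big| < \infty$. -/

import Mathlib

open MeasureTheory Real Filter

/-- Fubini for a nonnegative kernel on a product, where integrability in one order is enough. -/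
theorem integrableOn_and_setIntegral_eq_of_kernel {s t : Set ℝ} (hs : MeasurableSet s)
    (ht : MeasurableSet t) {F : ℝ → ℝ → ℝ} {φ ψ : ℝ → ℝ}
    (hF : AEStronglyMeasurable (Function.uncurry F) ((volume.restrict s).prod (volume.restrict t)))
    (hF0 : ∀ x ∈ s, ∀ y ∈ t, 0 ≤ F x y)
    (hint : ∀ x ∈ s, IntegrableOn (F x) t) (hφ : ∀ x ∈ s, ∫ y in t, F x y = φ x)
    (hψ : ∀ y ∈ t, ∫ x in s, F x y = ψ y) (hφi : IntegrableOn φ s) :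
    IntegrableOn ψ t ∧ ∫ y in t, ψ y = ∫ x in s, φ x := by
  have hprod : Integrable (Function.uncurry F) ((volume.restrict s).prod (volume.restrict t)) := by
    rw [integrable_prod_iff hF]
    refine ⟨(ae_restrict_iff' hs).2 (ae_of_all _ hint), hφi.congr ?_⟩
    refine (ae_restrict_iff' hs).2 (ae_of_all _ fun x hx => ?_)
    rw [← hφ x hx]
    refine setIntegral_congr_fun ht fun y hy => ?_
    simp [Function.uncurry, abs_of_nonneg (hF0 x hx y hy)]
  have hψ' : (fun y => ∫ x in s, F x y) =ᵐ[volume.restrict t] ψ :=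
    (ae_restrict_iff' ht).2 (ae_of_all _ hψ)
  refine ⟨hprod.integral_prod_right.congr hψ', ?_⟩
  rw [← integral_congr_ae hψ', ← integral_integral_swap hprod]
  exact setIntegral_congr_fun hs hφ

theorem rpow_sub_rpow_le {a p q : ℝ} (ha : 0 < a) (hp : 0 < p) (hpq : p ≤ q) :
    p ^ (a - 1) - q ^ (a - 1) ≤ p ^ (a - 1) * ((q - p) / q) := by
  have hq : 0 < q := hp.trans_le hpq
  have h1 : q ^ (a - 1) = p ^ (a - 1) * (p / q) ^ (1 - a) := by
    have e : q ^ (a - 1) = (q ^ (1 - a))⁻¹ := by rw [← rpow_neg hq.le]; ring_nf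
    rw [div_rpow hp.le hq.le, ← mul_div_assoc, ← rpow_add hp, e]
    simp
  have h2 : p / q ≤ (p / q) ^ (1 - a) := by
    conv_lhs => rw [← rpow_one (p / q)]
    exact rpow_le_rpow_of_exponent_ge (by positivity) (by rw [div_le_one hq]; exact hpq)
      (by linarith)
  have h3 : (q - p) / q = 1 - p / q := by field_simp
  rw [h1, h3, mul_sub, mul_one]
  gcongr

theorem mul_exp_neg_le_one (x : ℝ) : x * exp (-x) ≤ 1 := by
  have h := add_one_le_exp x
  rw [exp_neg, ← div_eq_mul_inv, div_le_one (exp_pos _)]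
  linarith

theorem mul_mul_exp_neg_le_two {x : ℝ} (hx : 0 ≤ x) : x * (x * exp (-x)) ≤ 2 := by
  have h := quadratic_le_exp_of_nonneg hx
  rw [← mul_assoc, exp_neg, ← div_eq_mul_inv, div_le_iff₀ (exp_pos _)]
  nlinarith

theorem intervalIntegrable_sub_rpow {a : ℝ} (ha : 0 < a) (T : ℝ) :
    IntervalIntegrable (fun x => (T - x) ^ (a - 1)) volume 0 T := by
  have h := (intervalIntegral.intervalIntegrable_rpow' (a := 0) (b := T)
    (show -1 < a - 1 by linarith)).comp_sub_left T
  simpa using h.symm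

theorem integral_sub_rpow {a : ℝ} (ha : 0 < a) (T : ℝ) :
    ∫ x in (0:ℝ)..T, (T - x) ^ (a - 1) = T ^ a / a := by
  rw [intervalIntegral.integral_comp_sub_left (fun x => x ^ (a - 1)) T,
    integral_rpow (Or.inl (by linarith))]
  simp [ha.ne']

/-- Convolving an integrable function `f` with `x f x` bounded against `x ^ (a - 1)` gives a
function of size `O(T ^ (a - 1))`. -/
theorem integral_mul_sub_rpow_le {a : ℝ} (ha : 0 < a) {f : ℝ → ℝ} {Q : ℝ}
    (hf : IntegrableOn f (Set.Ioi 0)) (hf0 : ∀ x, 0 < x → 0 ≤ f x)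
    (hQ : ∀ x, 0 < x → x * f x ≤ Q) {T : ℝ} (hT : 0 < T) :
    IntervalIntegrable (fun x => f x * (T - x) ^ (a - 1)) volume 0 T ∧
    ∫ x in (0:ℝ)..T, f x * (T - x) ^ (a - 1) ≤ ((∫ x in Set.Ioi 0, f x) + Q / a) * T ^ (a - 1) := by
  have hsub : Set.Ioo 0 T ⊆ Set.Ioi 0 := Set.Ioo_subset_Ioi_self
  have hfi : IntegrableOn f (Set.Ioo 0 T) := hf.mono_set hsub
  have hg : IntegrableOn (fun x => (T - x) ^ (a - 1)) (Set.Ioo 0 T) :=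
    (intervalIntegrable_iff_integrableOn_Ioo_of_le hT.le).1 (intervalIntegrable_sub_rpow ha T)
  have hb1 : ∀ x ∈ Set.Ioo 0 T, (T - x) ^ a ≤ T ^ a := fun x hx =>
    rpow_le_rpow (by linarith [hx.2]) (by linarith [hx.1]) ha.le
  have hi1 : IntegrableOn (fun x => f x * (T - x) ^ a) (Set.Ioo 0 T) := by
    refine Integrable.mul_bdd (c := T ^ a) hfi (by fun_prop (disch := exact ha.le)) ?_
    refine (ae_restrict_iff' measurableSet_Ioo).2 (ae_of_all _ fun x hx => ?_)
    rw [norm_of_nonneg (rpow_nonneg (by linarith [hx.2]) _)]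
    exact hb1 x hx
  have hi2 : IntegrableOn (fun x => (x * f x) * (T - x) ^ (a - 1)) (Set.Ioo 0 T) := by
    refine Integrable.bdd_mul (c := Q) hg
      (aestronglyMeasurable_id.mul hfi.aestronglyMeasurable) ?_
    refine (ae_restrict_iff' measurableSet_Ioo).2 (ae_of_all _ fun x hx => ?_)
    rw [norm_of_nonneg (mul_nonneg hx.1.le (hf0 x hx.1))]
    exact hQ x hx.1
  have key : ∀ x ∈ Set.Ioo 0 T, f x * (T - x) ^ (a - 1) =
      T⁻¹ * (f x * (T - x) ^ a + (x * f x) * (T - x) ^ (a - 1)) := by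
    intro x hx
    have : (T - x) ^ a = (T - x) ^ (a - 1) * (T - x) := by
      rw [← rpow_add_one (by linarith [hx.2])]; ring_nf
    rw [this]; field_simp; ring
  have hi3 := (hi1.add hi2).const_mul T⁻¹
  have hi : IntegrableOn (fun x => f x * (T - x) ^ (a - 1)) (Set.Ioo 0 T) :=
    IntegrableOn.congr_fun hi3 (fun x hx => (key x hx).symm) measurableSet_Ioo
  refine ⟨(intervalIntegrable_iff_integrableOn_Ioo_of_le hT.le).2 hi, ?_⟩
  have hI1 : ∫ x in Set.Ioo 0 T, f x * (T - x) ^ a ≤ (∫ x in Set.Ioi 0, f x) * T ^ a := by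
    calc _ ≤ ∫ x in Set.Ioo 0 T, f x * T ^ a :=
          setIntegral_mono_on hi1 (hfi.mul_const _) measurableSet_Ioo fun x hx =>
            mul_le_mul_of_nonneg_left (hb1 x hx) (hf0 x hx.1)
      _ = (∫ x in Set.Ioo 0 T, f x) * T ^ a := integral_mul_const _ _
      _ ≤ _ := by
          gcongr
          · exact (ae_restrict_iff' measurableSet_Ioi).2 (ae_of_all _ hf0)
  have hI2 : ∫ x in Set.Ioo 0 T, (x * f x) * (T - x) ^ (a - 1) ≤ Q * (T ^ a / a) := by
    calc _ ≤ ∫ x in Set.Ioo 0 T, Q * (T - x) ^ (a - 1) :=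
          setIntegral_mono_on hi2 (hg.const_mul _) measurableSet_Ioo fun x hx =>
            mul_le_mul_of_nonneg_right (hQ x hx.1) (rpow_nonneg (by linarith [hx.2]) _)
      _ = Q * (T ^ a / a) := by
          rw [integral_const_mul, ← integral_sub_rpow ha T,
            intervalIntegral.integral_of_le hT.le, integral_Ioc_eq_integral_Ioo]
  rw [intervalIntegral.integral_of_le hT.le, integral_Ioc_eq_integral_Ioo,
    setIntegral_congr_fun measurableSet_Ioo key, integral_const_mul, integral_add hi1 hi2]
  have hTa : T ^ a = T * T ^ (a - 1) := by
    rw [mul_comm, ← rpow_add_one hT.ne']; ring_nf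
  calc _ ≤ T⁻¹ * ((∫ x in Set.Ioi 0, f x) * T ^ a + Q * (T ^ a / a)) := by gcongr
    _ = _ := by rw [hTa]; field_simp

/-- The solution `y ↦ ∫_y^∞ exp (y - u) u ^ (a - 1) du` of `A' = A - y ^ (a - 1)`. -/
noncomputable def expTail (a y : ℝ) : ℝ := exp y * ∫ u in Set.Ioi y, exp (-u) * u ^ (a - 1)

/-- The solution `y ↦ ∫_0^y exp (u - y) u ^ (a - 1) du` of `B' = y ^ (a - 1) - B`. -/
noncomputable def expConv (a y : ℝ) : ℝ := exp (-y) * ∫ u in (0:ℝ)..y, exp u * u ^ (a - 1)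

section

variable {a : ℝ}

theorem integrableOn_exp_neg_mul_rpow (ha : 0 < a) {y : ℝ} (hy : 0 ≤ y) :
    IntegrableOn (fun u => exp (-u) * u ^ (a - 1)) (Set.Ioi y) :=
  (GammaIntegral_convergent ha).mono_set (Set.Ioi_subset_Ioi hy)

theorem integral_id_mul_exp_neg_Ioi :
    IntegrableOn (fun x : ℝ => x * exp (-x)) (Set.Ioi 0) ∧
      ∫ x in Set.Ioi (0:ℝ), x * exp (-x) = 1 := by
  have h1 := GammaIntegral_convergent (s := 2) (by norm_num)
  have h2 := Gamma_eq_integral (s := 2) (by norm_num)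
  have e : (fun x : ℝ => exp (-x) * x ^ ((2:ℝ) - 1)) = fun x => x * exp (-x) := by
    ext x; rw [show (2:ℝ) - 1 = 1 by norm_num, rpow_one, mul_comm]
  rw [e] at h1 h2
  exact ⟨h1, by rw [← h2, Gamma_two]⟩

theorem expTail_eq (ha : 0 < a) {y : ℝ} (hy : 0 ≤ y) :
    IntegrableOn (fun r => exp (-r) * (y + r) ^ (a - 1)) (Set.Ioi 0) ∧
      expTail a y = ∫ r in Set.Ioi 0, exp (-r) * (y + r) ^ (a - 1) := by
  have hm := measurePreserving_add_left (volume : Measure ℝ) y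
  have he := (Homeomorph.addLeft y).measurableEmbedding
  have hpre : (fun x => y + x) ⁻¹' Set.Ioi y = Set.Ioi 0 := by ext; simp
  have h2 := hm.setIntegral_preimage_emb he (fun u => exp (-u) * u ^ (a - 1)) (Set.Ioi y)
  have h1 := (hm.integrableOn_comp_preimage he (s := Set.Ioi y)).2
    (integrableOn_exp_neg_mul_rpow ha hy)
  rw [hpre] at h1 h2
  have e : ∀ r, exp y * (exp (-(y + r)) * (y + r) ^ (a - 1)) = exp (-r) * (y + r) ^ (a - 1) := by
    intro r
    rw [← mul_assoc, ← exp_add]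
    ring_nf
  constructor
  · exact (h1.const_mul (exp y)).congr (ae_of_all _ e)
  · rw [expTail, ← h2, ← integral_const_mul]
    simp only [e]

theorem integral_zero_exp_neg_mul_rpow (ha : 0 < a) {z : ℝ} (hz : 0 ≤ z) :
    ∫ v in (0:ℝ)..z, exp (-v) * v ^ (a - 1) = Gamma a - exp (-z) * expTail a z := by
  rw [← intervalIntegral.integral_Ioi_sub_Ioi (GammaIntegral_convergent ha) hz,
    Gamma_eq_integral ha, expTail, ← mul_assoc, ← exp_add]
  simp

theorem expTail_nonneg {y : ℝ} (hy : 0 ≤ y) : 0 ≤ expTail a y :=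
  mul_nonneg (exp_pos _).le <| setIntegral_nonneg measurableSet_Ioi fun _ hu =>
    mul_nonneg (exp_pos _).le (rpow_nonneg (hy.trans (Set.mem_Ioi.1 hu).le) _)

theorem expTail_le_Gamma (ha : 0 < a) (ha1 : a < 1) {y : ℝ} (hy : 0 ≤ y) :
    expTail a y ≤ Gamma a := by
  obtain ⟨hi, h⟩ := expTail_eq ha hy
  rw [h, Gamma_eq_integral ha]
  refine setIntegral_mono_on hi (GammaIntegral_convergent ha) measurableSet_Ioi fun r hr => ?_
  have hr' : 0 < r := hr
  exact mul_le_mul_of_nonneg_left (rpow_le_rpow_of_nonpos hr' (by linarith) (by linarith))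
    (exp_pos _).le

theorem expTail_le_rpow (ha : 0 < a) (ha1 : a < 1) {y : ℝ} (hy : 0 < y) :
    expTail a y ≤ y ^ (a - 1) := by
  obtain ⟨hi, h⟩ := expTail_eq ha hy.le
  calc _ ≤ ∫ r in Set.Ioi 0, exp (-r) * y ^ (a - 1) := by
        rw [h]
        refine setIntegral_mono_on hi ((integrableOn_exp_neg_Ioi 0).mul_const _) measurableSet_Ioi
          fun r hr => ?_
        have hr' : 0 < r := hr
        exact mul_le_mul_of_nonneg_left (rpow_le_rpow_of_nonpos hy (by linarith) (by linarith))
          (exp_pos _).le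
    _ = y ^ (a - 1) := by rw [integral_mul_const, integral_exp_neg_Ioi_zero, one_mul]

theorem rpow_sub_expTail_le (ha : 0 < a) {y : ℝ} (hy : 0 < y) :
    y ^ (a - 1) - expTail a y ≤ y ^ (a - 2) := by
  obtain ⟨hi, h⟩ := expTail_eq ha hy.le
  have hexp := (integrableOn_exp_neg_Ioi 0).mul_const (y ^ (a - 1))
  obtain ⟨hl, hl'⟩ := integral_id_mul_exp_neg_Ioi
  have e : y ^ (a - 1) = ∫ r in Set.Ioi 0, exp (-r) * y ^ (a - 1) := by
    rw [integral_mul_const, integral_exp_neg_Ioi_zero, one_mul]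
  have hy2 : y ^ (a - 2) = y ^ (a - 1) * y⁻¹ := by
    rw [← rpow_neg_one, ← rpow_add hy]; ring_nf
  calc _ = ∫ r in Set.Ioi 0, (exp (-r) * y ^ (a - 1) - exp (-r) * (y + r) ^ (a - 1)) := by
        rw [integral_sub hexp hi, ← e, h]
    _ ≤ ∫ r in Set.Ioi 0, (r * exp (-r)) * y ^ (a - 2) := by
        refine setIntegral_mono_on (hexp.sub hi) (hl.mul_const _) measurableSet_Ioi fun r hr => ?_
        have hr' : 0 < r := hr
        have h1 := rpow_sub_rpow_le ha hy (show y ≤ y + r by linarith)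
        have h2 : (y + r - y) / (y + r) ≤ r * y⁻¹ := by
          rw [add_sub_cancel_left, ← div_eq_mul_inv]; gcongr; linarith
        have h3 := mul_le_mul_of_nonneg_left h2 (rpow_nonneg hy.le (a - 1))
        have h4 := mul_le_mul_of_nonneg_left (h1.trans h3) (exp_pos (-r)).le
        rw [hy2]
        linarith
    _ = _ := by rw [integral_mul_const, hl', one_mul]

theorem hasDerivAt_expTail (ha : 0 < a) {y : ℝ} (hy : 0 < y) :
    HasDerivAt (expTail a) (expTail a y - y ^ (a - 1)) y := by
  have hi : IntervalIntegrable (fun v => exp (-v) * v ^ (a - 1)) volume 0 y :=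
    (intervalIntegrable_iff_integrableOn_Ioc_of_le hy.le).2
      ((GammaIntegral_convergent ha).mono_set Set.Ioc_subset_Ioi_self)
  have hc : ∀ x ∈ Set.Ioi (0:ℝ), ContinuousAt (fun v => exp (-v) * v ^ (a - 1)) x := fun x hx =>
    (by fun_prop : ContinuousAt (fun v : ℝ => exp (-v)) x).mul
      (continuousAt_rpow_const _ _ (Or.inl (ne_of_gt hx)))
  have hd := intervalIntegral.integral_hasDerivAt_right hi
    (ContinuousAt.stronglyMeasurableAtFilter isOpen_Ioi hc y hy) (hc y hy)
  have h1 := (hasDerivAt_exp y).mul (hd.const_sub (Gamma a))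
  have key : ∀ x, 0 < x →
      expTail a x = exp x * (Gamma a - ∫ v in (0:ℝ)..x, exp (-v) * v ^ (a - 1)) := by
    intro x hx
    rw [integral_zero_exp_neg_mul_rpow ha hx.le, sub_sub_cancel, ← mul_assoc, ← exp_add]
    simp
  refine (h1.congr_of_eventuallyEq ?_).congr_deriv ?_
  · filter_upwards [lt_mem_nhds hy] with x hx using key x hx
  · rw [← key y hy, mul_neg, ← mul_assoc, ← exp_add]
    simp [sub_eq_add_neg]

theorem intervalIntegrable_exp_mul_rpow (ha : 0 < a) (x y : ℝ) :
    IntervalIntegrable (fun u => exp u * u ^ (a - 1)) volume x y :=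
  (intervalIntegral.intervalIntegrable_rpow' (by linarith)).continuousOn_mul
    continuous_exp.continuousOn

theorem hasDerivAt_expConv (ha : 0 < a) {y : ℝ} (hy : 0 < y) :
    HasDerivAt (expConv a) (y ^ (a - 1) - expConv a y) y := by
  have hc : ∀ x ∈ Set.Ioi (0:ℝ), ContinuousAt (fun v => exp v * v ^ (a - 1)) x := fun x hx =>
    continuous_exp.continuousAt.mul (continuousAt_rpow_const _ _ (Or.inl (ne_of_gt hx)))
  have hd := intervalIntegral.integral_hasDerivAt_right (intervalIntegrable_exp_mul_rpow ha 0 y)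
    (ContinuousAt.stronglyMeasurableAtFilter isOpen_Ioi hc y hy) (hc y hy)
  refine ((hasDerivAt_neg y).exp.mul hd).congr_deriv ?_
  rw [← mul_assoc, ← exp_add, expConv]
  simp
  ring

theorem expConv_eq (y : ℝ) :
    expConv a y = ∫ r in (0:ℝ)..y, exp (-r) * (y - r) ^ (a - 1) := by
  have h := intervalIntegral.integral_comp_sub_left
    (fun u => exp (-y) * (exp u * u ^ (a - 1))) (a := 0) (b := y) y
  rw [sub_self, sub_zero] at h
  rw [expConv, ← intervalIntegral.integral_const_mul, ← h]
  congr 1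
  ext r
  rw [← mul_assoc, ← exp_add]
  ring_nf

theorem expConv_zero : expConv a 0 = 0 := by simp [expConv]

theorem expConv_nonneg {y : ℝ} (hy : 0 ≤ y) : 0 ≤ expConv a y :=
  mul_nonneg (exp_pos _).le <| intervalIntegral.integral_nonneg hy fun _ hu =>
    mul_nonneg (exp_pos _).le (rpow_nonneg hu.1 _)

theorem expConv_le (ha : 0 < a) {y : ℝ} (hy : 0 ≤ y) : expConv a y ≤ y ^ a / a := by
  have h : ∫ u in (0:ℝ)..y, exp u * u ^ (a - 1) ≤ ∫ u in (0:ℝ)..y, exp y * u ^ (a - 1) :=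
    intervalIntegral.integral_mono_on hy (intervalIntegrable_exp_mul_rpow ha 0 y)
      ((intervalIntegral.intervalIntegrable_rpow' (by linarith)).const_mul _)
      fun u hu => mul_le_mul_of_nonneg_right (exp_le_exp.2 hu.2) (rpow_nonneg hu.1 _)
  rw [intervalIntegral.integral_const_mul, integral_rpow (Or.inl (by linarith))] at h
  simp only [sub_add_cancel, zero_rpow ha.ne', sub_zero] at h
  calc _ ≤ exp (-y) * (exp y * (y ^ a / a)) := mul_le_mul_of_nonneg_left h (exp_pos _).le
    _ = _ := by rw [← mul_assoc, ← exp_add]; simp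

theorem expConv_le_rpow (ha : 0 < a) {y : ℝ} (hy : 0 < y) :
    expConv a y ≤ (1 + 1 / a) * y ^ (a - 1) := by
  have h := (integral_mul_sub_rpow_le ha (integrableOn_exp_neg_Ioi 0) (fun x _ => (exp_pos _).le)
    (fun x _ => mul_exp_neg_le_one x) hy).2
  rwa [← expConv_eq, integral_exp_neg_Ioi_zero] at h

theorem integral_exp_neg_zero (y : ℝ) : ∫ r in (0:ℝ)..y, exp (-r) = 1 - exp (-y) := by
  rw [intervalIntegral.integral_comp_neg (fun x => exp x), integral_exp]
  simp

theorem intervalIntegrable_exp_neg_mul_sub_rpow (ha : 0 < a) (y : ℝ) :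
    IntervalIntegrable (fun r => exp (-r) * (y - r) ^ (a - 1)) volume 0 y :=
  (intervalIntegrable_sub_rpow ha y).continuousOn_mul (by fun_prop)

theorem abs_rpow_sub_expConv_le (ha : 0 < a) (ha1 : a < 1) {y : ℝ} (hy : 0 < y) :
    |y ^ (a - 1) - expConv a y| ≤ (1 + 2 / a) * y ^ (a - 2) := by
  have hy2 : y ^ (a - 2) = y ^ (a - 1) * y⁻¹ := by
    rw [← rpow_neg_one, ← rpow_add hy]; ring_nf
  have hyp : 0 < y ^ (a - 1) := rpow_pos_of_pos hy _
  have hyp2 : 0 < y ^ (a - 2) := rpow_pos_of_pos hy _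
  have hi := intervalIntegrable_exp_neg_mul_sub_rpow ha y
  have hexp : IntervalIntegrable (fun r => exp (-r) * y ^ (a - 1)) volume 0 y :=
    (by fun_prop : Continuous fun r : ℝ => exp (-r) * y ^ (a - 1)).intervalIntegrable _ _
  have e : ∫ r in (0:ℝ)..y, (exp (-r) * (y - r) ^ (a - 1) - exp (-r) * y ^ (a - 1)) =
      expConv a y - (1 - exp (-y)) * y ^ (a - 1) := by
    rw [intervalIntegral.integral_sub hi hexp, intervalIntegral.integral_mul_const,
      ← expConv_eq, integral_exp_neg_zero]
  have hlow : 0 ≤ expConv a y - (1 - exp (-y)) * y ^ (a - 1) := by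
    rw [← e, intervalIntegral.integral_of_le hy.le, integral_Ioc_eq_integral_Ioo]
    refine setIntegral_nonneg measurableSet_Ioo fun r hr => ?_
    rw [← mul_sub]
    exact mul_nonneg (exp_pos _).le (sub_nonneg.2
      (rpow_le_rpow_of_nonpos (by linarith [hr.2]) (by linarith [hr.1]) (by linarith)))
  obtain ⟨hl, hl'⟩ := integral_id_mul_exp_neg_Ioi
  obtain ⟨hc1, hc2⟩ := integral_mul_sub_rpow_le ha hl
    (fun x hx => mul_nonneg hx.le (exp_pos _).le) (fun x hx => mul_mul_exp_neg_le_two hx.le) hy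
  have hup : expConv a y - (1 - exp (-y)) * y ^ (a - 1) ≤ (1 + 2 / a) * y ^ (a - 2) := by
    rw [← e]
    calc _ ≤ ∫ r in (0:ℝ)..y, (r * exp (-r) * (y - r) ^ (a - 1)) * y⁻¹ := by
          refine intervalIntegral.integral_mono_on_of_le_Ioo hy.le (hi.sub hexp)
            (hc1.mul_const _) fun r hr => ?_
          have h1 := rpow_sub_rpow_le ha (show 0 < y - r by linarith [hr.2])
            (show y - r ≤ y by linarith [hr.1])
          rw [sub_sub_cancel] at h1
          have := mul_le_mul_of_nonneg_left h1 (exp_pos (-r)).le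
          rw [← mul_sub]
          refine this.trans_eq ?_
          rw [div_eq_mul_inv]; ring
      _ ≤ _ := by
          rw [intervalIntegral.integral_mul_const, hy2, ← mul_assoc]
          rw [hl'] at hc2
          gcongr
  have hexp1 : exp (-y) * y ^ (a - 1) ≤ y ^ (a - 2) := by
    rw [hy2, mul_comm]
    gcongr
    have := mul_exp_neg_le_one y
    rwa [← one_div, le_div_iff₀ hy, mul_comm]
  have h2a : 0 < 2 / a := by positivity
  have h0 : 0 < exp (-y) * y ^ (a - 1) := by positivity
  rw [abs_le]
  constructor <;> nlinarith

theorem continuousOn_expTail (ha : 0 < a) : ContinuousOn (expTail a) (Set.Ioi 0) :=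
  fun _ hy => (hasDerivAt_expTail ha hy).continuousAt.continuousWithinAt

theorem continuousOn_expConv (ha : 0 < a) : ContinuousOn (expConv a) (Set.Ioi 0) :=
  fun _ hy => (hasDerivAt_expConv ha hy).continuousAt.continuousWithinAt

theorem continuousWithinAt_expConv_zero (ha : 0 < a) :
    ContinuousWithinAt (expConv a) (Set.Ici 0) 0 := by
  rw [ContinuousWithinAt, expConv_zero]
  have h : Tendsto (fun y : ℝ => y ^ a / a) (nhdsWithin 0 (Set.Ici 0)) (nhds 0) := by
    have := ((continuous_rpow_const ha.le).div_const a).tendsto 0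
    simp only [zero_rpow ha.ne', zero_div] at this
    exact this.mono_left nhdsWithin_le_nhds
  refine tendsto_of_tendsto_of_tendsto_of_le_of_le' tendsto_const_nhds h ?_ ?_
  · filter_upwards [self_mem_nhdsWithin] with y hy using expConv_nonneg hy
  · filter_upwards [self_mem_nhdsWithin] with y hy using expConv_le ha hy

theorem tendsto_expConv_atTop (ha : 0 < a) (ha1 : a < 1) :
    Tendsto (expConv a) atTop (nhds 0) := by
  have h : Tendsto (fun y : ℝ => (1 + 1 / a) * y ^ (a - 1)) atTop (nhds 0) := by
    have := (tendsto_rpow_neg_atTop (show 0 < 1 - a by linarith)).const_mul (1 + 1 / a)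
    simpa using this
  refine tendsto_of_tendsto_of_tendsto_of_le_of_le' tendsto_const_nhds h ?_ ?_
  · filter_upwards [eventually_gt_atTop 0] with y hy using expConv_nonneg hy.le
  · filter_upwards [eventually_gt_atTop 0] with y hy using expConv_le_rpow ha hy

theorem expConv_le_const (ha : 0 < a) (ha1 : a < 1) {y : ℝ} (hy : 0 ≤ y) :
    expConv a y ≤ 1 + 1 / a := by
  have ha' : 0 < 1 / a := by positivity
  rcases le_total y 1 with h | h
  · have h1 : y ^ a / a ≤ 1 / a := by gcongr; exact rpow_le_one hy h ha.le
    linarith [expConv_le ha hy]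
  · have h1 : y ^ (a - 1) ≤ 1 := rpow_le_one_of_one_le_of_nonpos h (by linarith)
    nlinarith [expConv_le_rpow ha (show 0 < y by linarith)]

theorem abs_expTail_sub_expConv_le_const (ha : 0 < a) (ha1 : a < 1) {y : ℝ} (hy : 0 ≤ y) :
    |expTail a y - expConv a y| ≤ Gamma a + (1 + 1 / a) := by
  have h1 := expTail_nonneg (a := a) hy
  have h2 := expTail_le_Gamma ha ha1 hy
  have h3 := expConv_nonneg (a := a) hy
  have h4 := expConv_le_const ha ha1 hy
  rw [abs_le]
  constructor <;> linarith

theorem abs_expTail_sub_expConv_le (ha : 0 < a) (ha1 : a < 1) {y : ℝ} (hy : 0 < y) :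
    |expTail a y - expConv a y| ≤ (2 + 2 / a) * y ^ (a - 2) := by
  have h1 := expTail_le_rpow ha ha1 hy
  have h2 := rpow_sub_expTail_le ha hy
  have h3 := abs_le.1 (abs_rpow_sub_expConv_le ha ha1 hy)
  have h4 : 0 < y ^ (a - 2) := rpow_pos_of_pos hy _
  rw [abs_le]
  constructor <;> linarith [h3.1, h3.2]

theorem mul_abs_expTail_sub_expConv_le (ha : 0 < a) (ha1 : a < 1) {y : ℝ} (hy : 0 < y) :
    y * |expTail a y - expConv a y| ≤ Gamma a + (2 + 2 / a) := by
  have hG := Gamma_pos_of_pos ha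
  have ha' : 2 / a = 2 * (1 / a) := by ring
  have ha'' : 0 < 1 / a := by positivity
  rcases le_total y 1 with h | h
  · have := abs_expTail_sub_expConv_le_const ha ha1 hy.le
    have := abs_nonneg (expTail a y - expConv a y)
    nlinarith
  · have h1 := mul_le_mul_of_nonneg_left (abs_expTail_sub_expConv_le ha ha1 hy) hy.le
    have h2 : y * y ^ (a - 2) ≤ 1 := by
      rw [mul_comm, ← rpow_add_one hy.ne']
      exact rpow_le_one_of_one_le_of_nonpos h (by linarith)
    have h3 : 0 < 2 + 2 / a := by positivity
    nlinarith

theorem integrableOn_expTail_sub_expConv (ha : 0 < a) (ha1 : a < 1) :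
    IntegrableOn (fun y => expTail a y - expConv a y) (Set.Ioi 0) := by
  have hc : ContinuousOn (fun y => expTail a y - expConv a y) (Set.Ioi 0) :=
    (continuousOn_expTail ha).sub (continuousOn_expConv ha)
  have hm := hc.aestronglyMeasurable (μ := volume) measurableSet_Ioi
  rw [← Set.Ioc_union_Ioi_eq_Ioi (zero_le_one' ℝ)]
  refine IntegrableOn.union ?_ ?_
  · refine Integrable.mono' (g := fun _ => Gamma a + (1 + 1 / a))
      (integrableOn_const (by simp)) (hm.mono_set Set.Ioc_subset_Ioi_self) ?_
    exact (ae_restrict_iff' measurableSet_Ioc).2 (ae_of_all _ fun y hy =>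
      abs_expTail_sub_expConv_le_const ha ha1 hy.1.le)
  · refine Integrable.mono' (g := fun y => (2 + 2 / a) * y ^ (a - 2))
      ((integrableOn_Ioi_rpow_of_lt (by linarith) one_pos).const_mul _)
      (hm.mono_set (Set.Ioi_subset_Ioi zero_le_one)) ?_
    exact (ae_restrict_iff' measurableSet_Ioi).2 (ae_of_all _ fun y hy =>
      abs_expTail_sub_expConv_le ha ha1 (zero_lt_one.trans hy))

theorem integrableOn_rpow_mul_exp_neg_mul {c r : ℝ} (hc : 0 < c) (hr : 0 < r) :
    IntegrableOn (fun t => t ^ (c - 1) * exp (-(r * t))) (Set.Ioi 0) := by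
  by_contra h
  have h1 := integral_undef h
  rw [integral_rpow_mul_exp_neg_mul_Ioi hc hr] at h1
  exact (mul_pos (rpow_pos_of_pos (by positivity) _) (Gamma_pos_of_pos hc)).ne' h1

theorem integrableOn_bounded_mul_exp {f : ℝ → ℝ} (hf : ContinuousOn f (Set.Ioi 0)) {C l : ℝ}
    (hC : ∀ y, 0 < y → |f y| ≤ C) (hl : 0 < l) :
    IntegrableOn (fun y => exp (-(l * y)) * f y) (Set.Ioi 0) := by
  have h := integrableOn_rpow_mul_exp_neg_mul one_pos hl
  simp only [sub_self, rpow_zero, one_mul] at h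
  exact Integrable.mul_bdd (c := C) h (hf.aestronglyMeasurable measurableSet_Ioi)
    ((ae_restrict_iff' measurableSet_Ioi).2 (ae_of_all _ hC))

theorem abs_expConv_le (ha : 0 < a) (ha1 : a < 1) (y : ℝ) (hy : 0 < y) :
    |expConv a y| ≤ 1 + 1 / a := by
  rw [abs_of_nonneg (expConv_nonneg hy.le)]
  exact expConv_le_const ha ha1 hy.le

theorem abs_expTail_le (ha : 0 < a) (ha1 : a < 1) (y : ℝ) (hy : 0 < y) :
    |expTail a y| ≤ Gamma a := by
  rw [abs_of_nonneg (expTail_nonneg hy.le)]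
  exact expTail_le_Gamma ha ha1 hy.le

theorem integral_exp_neg_mul_expConv (ha : 0 < a) (ha1 : a < 1) {l : ℝ} (hl : 0 < l) :
    ∫ y in Set.Ioi 0, exp (-(l * y)) * expConv a y = (1 / l) ^ a * Gamma a / (1 + l) := by
  have hB := integrableOn_bounded_mul_exp (continuousOn_expConv ha) (abs_expConv_le ha ha1) hl
  have hP := integrableOn_rpow_mul_exp_neg_mul ha hl
  have hder : ∀ y ∈ Set.Ioi (0:ℝ), HasDerivAt (fun y => exp (-(l * y)) * expConv a y)
      (y ^ (a - 1) * exp (-(l * y)) - (1 + l) * (exp (-(l * y)) * expConv a y)) y := by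
    intro y hy
    have h1 : HasDerivAt (fun y => exp (-(l * y))) (exp (-(l * y)) * -l) y := by
      simpa using ((hasDerivAt_id y).const_mul l).neg.exp
    exact (h1.mul (hasDerivAt_expConv ha hy)).congr_deriv (by ring)
  have hcont : ContinuousWithinAt (fun y => exp (-(l * y)) * expConv a y) (Set.Ici 0) 0 :=
    (by fun_prop : Continuous fun y : ℝ => exp (-(l * y))).continuousWithinAt.mul
      (continuousWithinAt_expConv_zero ha)
  have hlim : Tendsto (fun y => exp (-(l * y)) * expConv a y) atTop (nhds 0) := by
    have h1 : Tendsto (fun y => exp (-(l * y))) atTop (nhds 0) :=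
      tendsto_exp_neg_atTop_nhds_zero.comp (tendsto_id.const_mul_atTop hl)
    simpa using h1.mul (tendsto_expConv_atTop ha ha1)
  have h := integral_Ioi_of_hasDerivAt_of_tendsto hcont hder (hP.sub (hB.const_mul _)) hlim
  rw [integral_sub hP (hB.const_mul _), integral_const_mul,
    integral_rpow_mul_exp_neg_mul_Ioi ha hl, expConv_zero] at h
  rw [eq_div_iff (by linarith)]
  linarith

theorem integral_exp_neg_mul_expTail (ha : 0 < a) (ha1 : a < 1) :
    ∫ y in Set.Ioi 0, exp (-(1 * y)) * expTail a y = a * Gamma a := by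
  have hA := integrableOn_bounded_mul_exp (continuousOn_expTail ha) (abs_expTail_le ha ha1) one_pos
  have hP := integrableOn_rpow_mul_exp_neg_mul (show 0 < a + 1 by linarith) one_pos
  have hder : ∀ y ∈ Set.Ioi (0:ℝ), HasDerivAt (fun y => (y * exp (-(1 * y))) * expTail a y)
      (exp (-(1 * y)) * expTail a y - y ^ (a + 1 - 1) * exp (-(1 * y))) y := by
    intro y hy
    have h1 : HasDerivAt (fun y => exp (-(1 * y))) (exp (-(1 * y)) * -1) y := by
      simpa using ((hasDerivAt_id y).const_mul (1:ℝ)).neg.exp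
    have e : y ^ (a + 1 - 1) = y * y ^ (a - 1) := by
      rw [mul_comm, ← rpow_add_one (ne_of_gt hy)]; ring_nf
    refine (((hasDerivAt_id y).mul h1).mul (hasDerivAt_expTail ha hy)).congr_deriv ?_
    rw [e]
    simp only [id, Pi.mul_apply]
    ring
  have hcont : ContinuousWithinAt (fun y => (y * exp (-(1 * y))) * expTail a y) (Set.Ici 0) 0 := by
    have h1 : Tendsto (fun y : ℝ => y * exp (-(1 * y))) (nhdsWithin 0 (Set.Ici 0)) (nhds 0) := by
      have := (by fun_prop : Continuous fun y : ℝ => y * exp (-(1 * y))).tendsto 0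
      simp only [zero_mul] at this
      exact this.mono_left nhdsWithin_le_nhds
    rw [ContinuousWithinAt]
    simp only [zero_mul]
    refine h1.zero_mul_isBoundedUnder_le ⟨Gamma a, ?_⟩
    rw [eventually_map]
    filter_upwards [self_mem_nhdsWithin] with y hy
    simp only [Function.comp, norm_of_nonneg (expTail_nonneg (a := a) (Set.mem_Ici.1 hy))]
    exact expTail_le_Gamma ha ha1 hy
  have hlim : Tendsto (fun y => (y * exp (-(1 * y))) * expTail a y) atTop (nhds 0) := by
    have h1 : Tendsto (fun y : ℝ => y * exp (-(1 * y))) atTop (nhds 0) := by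
      simpa using tendsto_pow_mul_exp_neg_atTop_nhds_zero 1
    refine h1.zero_mul_isBoundedUnder_le ⟨Gamma a, ?_⟩
    rw [eventually_map]
    filter_upwards [eventually_ge_atTop 0] with y hy
    simp only [Function.comp, norm_of_nonneg (expTail_nonneg (a := a) hy)]
    exact expTail_le_Gamma ha ha1 hy
  have h := integral_Ioi_of_hasDerivAt_of_tendsto hcont hder (hA.sub hP) hlim
  rw [integral_sub hA hP, integral_rpow_mul_exp_neg_mul_Ioi (by linarith) one_pos,
    Gamma_add_one ha.ne'] at h
  simp only [div_one, one_rpow, one_mul, zero_mul, sub_self] at h ⊢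
  linarith

theorem integral_rpow_mul_exp_div (ha : 0 < a) (ha1 : a < 1) {y : ℝ} (hy : 0 < y) :
    IntegrableOn (fun l => l ^ (-a) * exp (-(y * l)) / (1 + l)) (Set.Ioi 0) ∧
      ∫ l in Set.Ioi 0, l ^ (-a) * exp (-(y * l)) / (1 + l) = Gamma (1 - a) * expTail a y := by
  obtain ⟨hi, he⟩ := expTail_eq ha hy.le
  have h := integrableOn_and_setIntegral_eq_of_kernel (s := Set.Ioi 0) (t := Set.Ioi 0)
    (F := fun r l => exp (-r) * (l ^ (1 - a - 1) * exp (-((y + r) * l))))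
    (φ := fun r => Gamma (1 - a) * (exp (-r) * (y + r) ^ (a - 1)))
    (ψ := fun l => l ^ (-a) * exp (-(y * l)) / (1 + l)) measurableSet_Ioi measurableSet_Ioi
    (by unfold Function.uncurry; fun_prop)
    (fun x _ l hl => mul_nonneg (exp_pos _).le (mul_nonneg (rpow_nonneg (le_of_lt hl) _)
      (exp_pos _).le))
    (fun r hr => (integrableOn_rpow_mul_exp_neg_mul (by linarith)
      (add_pos hy hr)).const_mul _) ?_ ?_ (hi.const_mul _)
  · refine ⟨h.1, h.2.trans ?_⟩
    rw [integral_const_mul, ← he]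
  · intro r hr
    have hr' : 0 < y + r := add_pos hy hr
    rw [integral_const_mul, integral_rpow_mul_exp_neg_mul_Ioi (by linarith) hr', one_div,
      inv_rpow hr'.le, ← rpow_neg hr'.le]
    ring_nf
  · intro l hl
    have hl' : 0 < 1 + l := add_pos one_pos hl
    have e : ∀ r, exp (-r) * (l ^ (1 - a - 1) * exp (-((y + r) * l))) =
        (l ^ (-a) * exp (-(y * l))) * (r ^ ((1:ℝ) - 1) * exp (-((1 + l) * r))) := by
      intro r
      rw [show 1 - a - 1 = -a by ring, sub_self, rpow_zero, one_mul, mul_assoc,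
        mul_left_comm, ← exp_add, ← exp_add]
      ring_nf
    simp only [e]
    rw [integral_const_mul, integral_rpow_mul_exp_neg_mul_Ioi one_pos hl']
    simp [div_eq_mul_inv]

theorem integral_rpow_mul_exp_div' (ha : 0 < a) (ha1 : a < 1) {y : ℝ} (hy : 0 < y) :
    ∫ l in Set.Ioi 0, l ^ (1 - a) * exp (-(y * l)) / (1 + l) =
      Gamma (1 - a) * (y ^ (a - 1) - expTail a y) := by
  obtain ⟨hi, he⟩ := integral_rpow_mul_exp_div ha ha1 hy
  have h1 := integrableOn_rpow_mul_exp_neg_mul (show 0 < 1 - a by linarith) hy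
  have h2 := integral_rpow_mul_exp_neg_mul_Ioi (show 0 < 1 - a by linarith) hy
  rw [mul_sub, ← he]
  rw [one_div, inv_rpow hy.le, ← rpow_neg hy.le, neg_sub, mul_comm] at h2
  rw [← h2, ← integral_sub h1 hi]
  refine setIntegral_congr_fun measurableSet_Ioi fun l hl => ?_
  have hl0 : 0 < l := hl
  have e : l ^ (1 - a) = l * l ^ (-a) := by
    rw [mul_comm, ← rpow_add_one hl0.ne']; ring_nf
  have hl' : 1 + l ≠ 0 := by positivity
  simp only [e, show 1 - a - 1 = -a by ring]
  field_simp
  ring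

theorem integral_rpow_div_one_add_sq (ha : 0 < a) (ha1 : a < 1) :
    IntegrableOn (fun l : ℝ => l ^ (1 - 2 * a) / (1 + l) ^ 2) (Set.Ioi 0) ∧
      ∫ l in Set.Ioi 0, l ^ (1 - 2 * a) / (1 + l) ^ 2 = Gamma (2 - 2 * a) * Gamma (2 * a) := by
  have hi := GammaIntegral_convergent (show 0 < 2 * a by linarith)
  have h := integrableOn_and_setIntegral_eq_of_kernel (s := Set.Ioi 0) (t := Set.Ioi 0)
    (F := fun s l => (s * exp (-s)) * (l ^ (2 - 2 * a - 1) * exp (-(s * l))))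
    (φ := fun s => Gamma (2 - 2 * a) * (exp (-s) * s ^ (2 * a - 1)))
    (ψ := fun l => l ^ (1 - 2 * a) / (1 + l) ^ 2) measurableSet_Ioi measurableSet_Ioi
    (by unfold Function.uncurry; fun_prop)
    (fun x hx l hl => mul_nonneg (mul_nonneg (le_of_lt hx) (exp_pos _).le)
      (mul_nonneg (rpow_nonneg (le_of_lt hl) _) (exp_pos _).le))
    (fun s hs => (integrableOn_rpow_mul_exp_neg_mul (by linarith) hs).const_mul _) ?_ ?_
    (hi.const_mul _)
  · refine ⟨h.1, h.2.trans ?_⟩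
    rw [integral_const_mul, ← Gamma_eq_integral (by linarith)]
  · intro s hs
    have hs' : 0 < s := hs
    have e : s ^ (2 * a - 1) = s * s ^ (-(2 - 2 * a)) := by
      rw [mul_comm s, ← rpow_add_one hs'.ne']; congr 1; ring
    rw [integral_const_mul, integral_rpow_mul_exp_neg_mul_Ioi (by linarith) hs', one_div,
      inv_rpow hs'.le, ← rpow_neg hs'.le, e]
    ring
  · intro l hl
    have hl' : 0 < 1 + l := add_pos one_pos hl
    have e : ∀ s, (s * exp (-s)) * (l ^ (2 - 2 * a - 1) * exp (-(s * l))) =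
        l ^ (1 - 2 * a) * (s ^ ((2:ℝ) - 1) * exp (-((1 + l) * s))) := by
      intro s
      rw [show -((1 + l) * s) = -s + -(s * l) by ring, exp_add, show (2:ℝ) - 1 = 1 by norm_num,
        rpow_one, show 2 - 2 * a - 1 = 1 - 2 * a by ring]
      ring
    simp only [e]
    rw [integral_const_mul, integral_rpow_mul_exp_neg_mul_Ioi two_pos hl', Gamma_two, rpow_two]
    simp [div_eq_mul_inv]

theorem integral_rpow_sub_expTail_mul_expConv (ha : 0 < a) (ha1 : a < 1) :
    IntegrableOn (fun y => (y ^ (a - 1) - expTail a y) * expConv a y) (Set.Ioi 0) ∧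
      ∫ y in Set.Ioi 0, (y ^ (a - 1) - expTail a y) * expConv a y =
        Gamma a * Gamma (2 - 2 * a) * Gamma (2 * a) / Gamma (1 - a) := by
  have hG : 0 < Gamma (1 - a) := Gamma_pos_of_pos (by linarith)
  obtain ⟨hi, he⟩ := integral_rpow_div_one_add_sq ha ha1
  have h := integrableOn_and_setIntegral_eq_of_kernel (s := Set.Ioi 0) (t := Set.Ioi 0)
    (F := fun l y => l ^ (1 - a) / (1 + l) * (exp (-(l * y)) * expConv a y))
    (φ := fun l => Gamma a * (l ^ (1 - 2 * a) / (1 + l) ^ 2))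
    (ψ := fun y => Gamma (1 - a) * ((y ^ (a - 1) - expTail a y) * expConv a y))
    measurableSet_Ioi measurableSet_Ioi ?_
    (fun l hl y hy => mul_nonneg (div_nonneg (rpow_nonneg (le_of_lt hl) _)
      (add_pos one_pos hl).le) (mul_nonneg (exp_pos _).le (expConv_nonneg (le_of_lt hy))))
    (fun l hl => (integrableOn_bounded_mul_exp (continuousOn_expConv ha)
      (abs_expConv_le ha ha1) hl).const_mul _) ?_ ?_ (hi.const_mul _)
  · obtain ⟨h1, h2⟩ := h
    rw [integral_const_mul, integral_const_mul, he] at h2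
    constructor
    · refine (h1.const_mul (Gamma (1 - a))⁻¹).congr (ae_of_all _ fun y => ?_)
      simp only
      field_simp
    · rw [eq_div_iff hG.ne']
      linarith
  · have hm : AEStronglyMeasurable (fun p : ℝ × ℝ => expConv a p.2)
        ((volume.restrict (Set.Ioi 0)).prod (volume.restrict (Set.Ioi 0))) :=
      ((continuousOn_expConv ha).aestronglyMeasurable measurableSet_Ioi).comp_snd
    unfold Function.uncurry
    exact AEStronglyMeasurable.mul (Measurable.aestronglyMeasurable (by fun_prop)) (AEStronglyMeasurable.mul (by fun_prop) hm)
  · intro l hl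
    have hl0 : 0 < l := hl
    have e : l ^ (1 - 2 * a) = l ^ (1 - a) * l ^ (-a) := by
      rw [← rpow_add hl0]; ring_nf
    rw [integral_const_mul, integral_exp_neg_mul_expConv ha ha1 hl, one_div, inv_rpow hl0.le,
      ← rpow_neg hl0.le, e]
    have hl' : 1 + l ≠ 0 := by positivity
    field_simp
  · intro y hy
    rw [← mul_assoc, ← integral_rpow_mul_exp_div' ha ha1 hy, ← integral_mul_const]
    congr 1
    ext l
    ring_nf

/-- The value of the limiting integral. -/
theorem integral_expTail_sub_expConv_mul (ha : 0 < a) (ha1 : a < 1) :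
    IntegrableOn (fun y => (expTail a y - expConv a y) * (Gamma a * exp (-y) - expConv a y))
      (Set.Ioi 0) ∧
    ∫ y in Set.Ioi 0, (expTail a y - expConv a y) * (Gamma a * exp (-y) - expConv a y) =
      Gamma a ^ 2 * (a - 1 / 2) + Gamma a * Gamma (2 - 2 * a) * Gamma (2 * a) / Gamma (1 - a) := by
  obtain ⟨hD, hD'⟩ := integral_rpow_sub_expTail_mul_expConv ha ha1
  have hA := integrableOn_bounded_mul_exp (continuousOn_expTail ha) (abs_expTail_le ha ha1) one_pos
  have hB := integrableOn_bounded_mul_exp (continuousOn_expConv ha) (abs_expConv_le ha ha1) one_pos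
  have hA' := integral_exp_neg_mul_expTail ha ha1
  have hB' := integral_exp_neg_mul_expConv ha ha1 one_pos
  have hGB : IntegrableOn (fun y => (expTail a y - expConv a y) * expConv a y) (Set.Ioi 0) :=
    Integrable.mul_bdd (c := 1 + 1 / a) (integrableOn_expTail_sub_expConv ha ha1)
      ((continuousOn_expConv ha).aestronglyMeasurable measurableSet_Ioi)
      ((ae_restrict_iff' measurableSet_Ioi).2 (ae_of_all _ (abs_expConv_le ha ha1)))
  have hBB := integral_Ioi_of_hasDerivAt_of_tendsto (f := fun y => expConv a y * expConv a y)
    (f' := fun y => 2 * ((y ^ (a - 1) - expTail a y) * expConv a y +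
      (expTail a y - expConv a y) * expConv a y))
    ((continuousWithinAt_expConv_zero ha).mul (continuousWithinAt_expConv_zero ha))
    (fun y hy => ((hasDerivAt_expConv ha hy).mul (hasDerivAt_expConv ha hy)).congr_deriv
      (by ring)) ((hD.add hGB).const_mul 2)
    ((tendsto_expConv_atTop ha ha1).mul (tendsto_expConv_atTop ha ha1))
  rw [integral_const_mul, integral_add hD hGB, hD'] at hBB
  simp only [expConv_zero, mul_zero, sub_self] at hBB
  have e : ∀ y, Gamma a * (exp (-(1 * y)) * expTail a y - exp (-(1 * y)) * expConv a y) -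
      (expTail a y - expConv a y) * expConv a y =
      (expTail a y - expConv a y) * (Gamma a * exp (-y) - expConv a y) := by
    intro y; rw [one_mul]; ring
  have hAB : IntegrableOn (fun y => Gamma a * (exp (-(1 * y)) * expTail a y -
      exp (-(1 * y)) * expConv a y)) (Set.Ioi 0) := (hA.sub hB).const_mul (Gamma a)
  refine ⟨(hAB.sub hGB).congr (ae_of_all _ e), ?_⟩
  simp only [← e]
  rw [integral_sub hAB hGB, integral_const_mul, integral_sub hA hB,
    hA', hB']
  simp only [div_one, one_rpow, one_mul]
  linarith

end

theorem intervalIntegrable_and_integral_congr_Ioo {f g : ℝ → ℝ} {b c : ℝ} (hbc : b ≤ c)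
    (hg : IntervalIntegrable g volume b c) (h : ∀ x ∈ Set.Ioo b c, f x = g x) :
    IntervalIntegrable f volume b c ∧ ∫ x in b..c, f x = ∫ x in b..c, g x := by
  rw [intervalIntegrable_iff_integrableOn_Ioo_of_le hbc] at hg ⊢
  refine ⟨hg.congr_fun (fun x hx => (h x hx).symm) measurableSet_Ioo, ?_⟩
  simp only [intervalIntegral.integral_of_le hbc, integral_Ioc_eq_integral_Ioo]
  exact setIntegral_congr_fun measurableSet_Ioo h

section

variable {a : ℝ}

theorem integral_sign_mul_rpow_sub_rpow (ha : 0 < a) {T y : ℝ} (hy : 0 < y) (hyT : y < T) :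
    ∫ u in (0:ℝ)..T, exp (-|y - u|) * Real.sign (u - y) * (T ^ (a - 1) - u ^ (a - 1)) =
      -(expTail a y - expConv a y) + T ^ (a - 1) * (exp (-y) - exp (-(T - y))) +
        exp (-(T - y)) * expTail a T := by
  have hT := hy.trans hyT
  have h1i := intervalIntegrable_exp_mul_rpow ha 0 y
  have h1e : IntervalIntegrable (fun u => exp u * T ^ (a - 1)) volume 0 y :=
    (by fun_prop : Continuous fun u : ℝ => exp u * T ^ (a - 1)).intervalIntegrable _ _
  have h2i : IntervalIntegrable (fun u => exp (-u) * u ^ (a - 1)) volume y T :=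
    (intervalIntegral.intervalIntegrable_rpow' (by linarith)).continuousOn_mul (by fun_prop)
  have h2e : IntervalIntegrable (fun u => exp (-u) * T ^ (a - 1)) volume y T :=
    (by fun_prop : Continuous fun u : ℝ => exp (-u) * T ^ (a - 1)).intervalIntegrable _ _
  obtain ⟨i1, e1⟩ := intervalIntegrable_and_integral_congr_Ioo
    (f := fun u => exp (-|y - u|) * Real.sign (u - y) * (T ^ (a - 1) - u ^ (a - 1))) hy.le
    ((h1i.sub h1e).const_mul (exp (-y))) fun u hu => by
      rw [abs_of_pos (by linarith [hu.2]), Real.sign_of_neg (by linarith [hu.2]), neg_sub,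
        sub_eq_add_neg, exp_add]
      ring
  obtain ⟨i2, e2⟩ := intervalIntegrable_and_integral_congr_Ioo
    (f := fun u => exp (-|y - u|) * Real.sign (u - y) * (T ^ (a - 1) - u ^ (a - 1))) hyT.le
    ((h2e.sub h2i).const_mul (exp y)) fun u hu => by
      rw [abs_of_neg (by linarith [hu.1]), Real.sign_of_pos (by linarith [hu.1]), neg_neg,
        sub_eq_add_neg, exp_add]
      ring
  have hA : ∫ u in y..T, exp (-u) * u ^ (a - 1) =
      exp (-y) * expTail a y - exp (-T) * expTail a T := by
    rw [← intervalIntegral.integral_Ioi_sub_Ioi (integrableOn_exp_neg_mul_rpow ha hy.le) hyT.le,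
      expTail, expTail, ← mul_assoc, ← mul_assoc, ← exp_add, ← exp_add]
    simp
  have hexp : ∫ u in y..T, exp (-u) = exp (-y) - exp (-T) := by
    rw [intervalIntegral.integral_comp_neg (fun x => exp x), integral_exp]
  rw [← intervalIntegral.integral_add_adjacent_intervals i1 i2, e1, e2,
    intervalIntegral.integral_const_mul, intervalIntegral.integral_const_mul,
    intervalIntegral.integral_sub h1i h1e, intervalIntegral.integral_sub h2e h2i, hA,
    intervalIntegral.integral_mul_const, intervalIntegral.integral_mul_const, hexp, integral_exp,
    mul_sub (exp (-y)), ← expConv, neg_sub, exp_zero,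
    show -(T - y) = y + -T by ring, exp_add]
  have h : exp (-y) = (exp y)⁻¹ := exp_neg y
  rw [h]
  field_simp
  ring

theorem integral_exp_mul_sub_sign_mul_rpow (ha : 0 < a) {T y : ℝ} (hy : 0 < y) (hyT : y < T) :
    ∫ x in (0:ℝ)..T, exp (-x) * ((T - y) ^ (a - 1) - Real.sign (x - y) * |x - y| ^ (a - 1)) =
      (1 - exp (-T)) * (T - y) ^ (a - 1) - (Gamma a * exp (-y) - expConv a y) +
        exp (-T) * expTail a (T - y) := by
  have hce : ∀ b c : ℝ, IntervalIntegrable (fun x => exp (-x) * (T - y) ^ (a - 1)) volume b c :=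
    fun b c =>
    (by fun_prop : Continuous fun u : ℝ => exp (-u) * (T - y) ^ (a - 1)).intervalIntegrable _ _
  have h1 := intervalIntegrable_exp_neg_mul_sub_rpow ha y
  have h2' : IntervalIntegrable (fun v => exp (-v) * v ^ (a - 1)) volume 0 (T - y) :=
    (intervalIntegral.intervalIntegrable_rpow' (by linarith)).continuousOn_mul (by fun_prop)
  have h2 : IntervalIntegrable (fun x => exp (-(x - y)) * (x - y) ^ (a - 1)) volume y T := by
    simpa using h2'.comp_sub_right y
  obtain ⟨i1, e1⟩ := intervalIntegrable_and_integral_congr_Ioo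
    (f := fun x => exp (-x) * ((T - y) ^ (a - 1) - Real.sign (x - y) * |x - y| ^ (a - 1))) hy.le
    ((hce 0 y).add h1) fun x hx => by
      rw [abs_of_neg (by linarith [hx.2]), Real.sign_of_neg (by linarith [hx.2]), neg_sub]
      ring
  obtain ⟨i2, e2⟩ := intervalIntegrable_and_integral_congr_Ioo
    (f := fun x => exp (-x) * ((T - y) ^ (a - 1) - Real.sign (x - y) * |x - y| ^ (a - 1))) hyT.le
    ((hce y T).sub (h2.const_mul (exp (-y)))) fun x hx => by
      rw [abs_of_pos (by linarith [hx.1]), Real.sign_of_pos (by linarith [hx.1]), ← mul_assoc,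
        ← exp_add]
      ring_nf
  have e3 : ∫ x in y..T, exp (-(x - y)) * (x - y) ^ (a - 1) =
      Gamma a - exp (-(T - y)) * expTail a (T - y) := by
    rw [intervalIntegral.integral_comp_sub_right (fun v => exp (-v) * v ^ (a - 1)) y, sub_self,
      integral_zero_exp_neg_mul_rpow ha (by linarith)]
  have e4 := intervalIntegral.integral_add_adjacent_intervals (hce 0 y) (hce y T)
  rw [intervalIntegral.integral_mul_const _ (fun x => exp (-x)) (a := 0) (b := T),
    integral_exp_neg_zero] at e4
  rw [← intervalIntegral.integral_add_adjacent_intervals i1 i2, e1, e2,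
    intervalIntegral.integral_add (hce 0 y) h1, ← expConv_eq,
    intervalIntegral.integral_sub (hce y T) (h2.const_mul _),
    intervalIntegral.integral_const_mul, e3, ← e4]
  have h : exp (-T) = exp (-y) * exp (-(T - y)) := by rw [← exp_add]; ring_nf
  rw [h]
  ring

theorem integrableOn_sign_mul_abs_rpow (ha : 0 < a) (T : ℝ) (hT : 0 < T) :
    IntegrableOn (fun v => Real.sign v * |v| ^ (a - 1)) (Set.Icc (-T) T) := by
  have hp : IntervalIntegrable (fun v : ℝ => v ^ (a - 1)) volume 0 T :=
    intervalIntegral.intervalIntegrable_rpow' (by linarith)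
  obtain ⟨i1, -⟩ := intervalIntegrable_and_integral_congr_Ioo
    (f := fun v => Real.sign v * |v| ^ (a - 1)) hT.le hp fun x hx => by
      rw [abs_of_pos hx.1, Real.sign_of_pos hx.1, one_mul]
  have hn : IntervalIntegrable (fun v : ℝ => -(-v) ^ (a - 1)) volume (-T) 0 := by
    have h := (hp.comp_sub_left 0).symm
    simp only [zero_sub, sub_zero] at h
    exact h.neg
  obtain ⟨i2, -⟩ := intervalIntegrable_and_integral_congr_Ioo
    (f := fun v => Real.sign v * |v| ^ (a - 1)) (by linarith) hn fun x hx => by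
      rw [abs_of_neg hx.2, Real.sign_of_neg hx.2, neg_one_mul]
  exact (intervalIntegrable_iff_integrableOn_Icc_of_le (by linarith)).1 (i2.trans i1)

theorem integrable_sign_sub_mul_abs_rpow (ha : 0 < a) {T : ℝ} (hT : 0 < T) :
    Integrable (fun p : ℝ × ℝ => Real.sign (p.1 - p.2) * |p.1 - p.2| ^ (a - 1))
      ((volume.restrict (Set.Ioo 0 T)).prod (volume.restrict (Set.Ioo 0 T))) := by
  have hf : Integrable ((Set.Ioo 0 T).indicator fun _ : ℝ => (1:ℝ)) :=
    (integrable_indicator_iff measurableSet_Ioo).2 (integrableOn_const (by simp))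
  have hg := (integrable_indicator_iff measurableSet_Icc).2 (integrableOn_sign_mul_abs_rpow ha T hT)
  have h := (Integrable.convolution_integrand (ContinuousLinearMap.mul ℝ ℝ) hf hg).integrableOn
    (s := Set.Ioo 0 T ×ˢ Set.Ioo 0 T)
  rw [Measure.prod_restrict]
  refine IntegrableOn.congr_fun h (fun p hp => ?_) (measurableSet_Ioo.prod measurableSet_Ioo)
  have h1 := hp.1
  have h2 := hp.2
  rw [Set.indicator_of_mem h2, Set.indicator_of_mem]
  · simp
  · exact ⟨by linarith [h1.1, h2.2], by linarith [h1.2, h2.1]⟩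

theorem triple_integral_eq (ha : 0 < a) (ha1 : a < 1) {T : ℝ} (hT : 0 < T) :
    (∫ t1 in (0:ℝ)..T, ∫ t2 in (0:ℝ)..T, ∫ s in (0:ℝ)..T,
        exp (t1 - T - |s - t2|) * Real.sign (t2 - s) *
          (T ^ (a - 1) - (T - s) ^ (a - 1)) *
          (t2 ^ (a - 1) - Real.sign (t2 - t1) * |t2 - t1| ^ (a - 1))) =
      ∫ y in Set.Ioo 0 T, (-(expTail a y - expConv a y) +
          T ^ (a - 1) * (exp (-y) - exp (-(T - y))) + exp (-(T - y)) * expTail a T) *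
        ((1 - exp (-T)) * (T - y) ^ (a - 1) - (Gamma a * exp (-y) - expConv a y) +
          exp (-T) * expTail a (T - y)) := by
  set g : ℝ → ℝ := fun y => -(expTail a y - expConv a y) +
    T ^ (a - 1) * (exp (-y) - exp (-(T - y))) + exp (-(T - y)) * expTail a T with hg
  have hrefl : ∀ f : ℝ → ℝ, ∫ t in (0:ℝ)..T, f t = ∫ t in (0:ℝ)..T, f (T - t) := fun f => by
    rw [intervalIntegral.integral_comp_sub_left f T, sub_self, sub_zero]
  have hIoo : ∀ f : ℝ → ℝ, ∫ t in (0:ℝ)..T, f t = ∫ t in Set.Ioo 0 T, f t := fun f => by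
    rw [intervalIntegral.integral_of_le hT.le, integral_Ioc_eq_integral_Ioo]
  have hinner : ∀ x, ∫ t2 in (0:ℝ)..T, ∫ s in (0:ℝ)..T,
      exp (T - x - T - |s - t2|) * Real.sign (t2 - s) *
          (T ^ (a - 1) - (T - s) ^ (a - 1)) *
          (t2 ^ (a - 1) - Real.sign (t2 - (T - x)) * |t2 - (T - x)| ^ (a - 1)) =
      ∫ y in Set.Ioo 0 T,
        g y * (exp (-x) * ((T - y) ^ (a - 1) - Real.sign (x - y) * |x - y| ^ (a - 1))) := by
    intro x
    rw [hrefl, hIoo]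
    refine setIntegral_congr_fun measurableSet_Ioo fun y hy => ?_
    simp only [hg]
    rw [hrefl, ← integral_sign_mul_rpow_sub_rpow ha hy.1 hy.2, ← intervalIntegral.integral_mul_const]
    congr 1
    ext u
    rw [show T - x - T - |T - u - (T - y)| = -x + -|y - u| by ring_nf, exp_add,
      show T - y - (T - u) = u - y by ring, show T - (T - u) = u by ring,
      show T - y - (T - x) = x - y by ring]
    ring
  have hgm : AEStronglyMeasurable g (volume.restrict (Set.Ioo 0 T)) := by
    refine ContinuousOn.aestronglyMeasurable ?_ measurableSet_Ioo
    have hA := (continuousOn_expTail ha).mono (Set.Ioo_subset_Ioi_self : Set.Ioo 0 T ⊆ _)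
    have hB := (continuousOn_expConv ha).mono (Set.Ioo_subset_Ioi_self : Set.Ioo 0 T ⊆ _)
    exact ((hA.sub hB).neg.add (by fun_prop)).add (by fun_prop)
  have hgb : ∀ y ∈ Set.Ioo 0 T, |g y| ≤ (Gamma a + (1 + 1 / a)) + T ^ (a - 1) + T ^ (a - 1) := by
    intro y hy
    have h1 := abs_le.1 (abs_expTail_sub_expConv_le_const ha ha1 hy.1.le)
    have hp : 0 < T ^ (a - 1) := rpow_pos_of_pos hT _
    have h2 : exp (-y) ≤ 1 := exp_le_one_iff.2 (by linarith [hy.1])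
    have h3 : exp (-(T - y)) ≤ 1 := exp_le_one_iff.2 (by linarith [hy.2])
    have h4 := exp_pos (-y)
    have h5 := exp_pos (-(T - y))
    have h6 := expTail_nonneg (a := a) hT.le
    have h7 := expTail_le_rpow ha ha1 hT
    have h8 : exp (-(T - y)) * expTail a T ≤ T ^ (a - 1) := by nlinarith
    have h9 : 0 ≤ exp (-(T - y)) * expTail a T := by positivity
    simp only [hg]
    rw [abs_le]
    constructor <;> nlinarith [h1.1, h1.2]
  set μ := volume.restrict (Set.Ioo 0 T) with hμ
  have hae : ∀ᵐ y ∂μ, |g y| ≤ (Gamma a + (1 + 1 / a)) + T ^ (a - 1) + T ^ (a - 1) :=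
    (ae_restrict_iff' measurableSet_Ioo).2 (ae_of_all _ hgb)
  have hsub : Integrable (fun y => (T - y) ^ (a - 1)) μ :=
    (intervalIntegrable_iff_integrableOn_Ioo_of_le hT.le).1 (intervalIntegrable_sub_rpow ha T)
  have hexp : Integrable (fun x => exp (-x)) μ :=
    (integrableOn_exp_neg_Ioi 0).mono_set Set.Ioo_subset_Ioi_self
  have hprod : Integrable (Function.uncurry fun x y =>
      g y * (exp (-x) * ((T - y) ^ (a - 1) - Real.sign (x - y) * |x - y| ^ (a - 1))))
      (μ.prod μ) := by
    have h1 : Integrable (fun p : ℝ × ℝ => exp (-p.1) * (T - p.2) ^ (a - 1)) (μ.prod μ) :=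
      hexp.mul_prod hsub
    have h2 : Integrable (fun p : ℝ × ℝ => exp (-p.1) * (Real.sign (p.1 - p.2) *
        |p.1 - p.2| ^ (a - 1))) (μ.prod μ) := by
      refine (integrable_sign_sub_mul_abs_rpow ha hT).bdd_mul (c := 1)
        (Measurable.aestronglyMeasurable (by fun_prop)) ?_
      rw [Measure.prod_restrict]
      refine (ae_restrict_iff' (measurableSet_Ioo.prod measurableSet_Ioo)).2
        (ae_of_all _ fun p hp => ?_)
      rw [norm_of_nonneg (exp_pos _).le]
      exact exp_le_one_iff.2 (by linarith [hp.1.1])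
    refine ((h1.sub h2).bdd_mul hgm.comp_snd (Measure.quasiMeasurePreserving_snd.ae hae)).congr
      (ae_of_all _ fun p => ?_)
    simp only [Function.uncurry, Pi.sub_apply]
    ring
  rw [hrefl]
  simp_rw [hinner]
  rw [hIoo, integral_integral_swap hprod]
  refine setIntegral_congr_fun measurableSet_Ioo fun y hy => ?_
  rw [integral_const_mul, hμ, ← hIoo, integral_exp_mul_sub_sign_mul_rpow ha hy.1 hy.2]

theorem abs_Gamma_mul_exp_sub_expConv_le (ha : 0 < a) (ha1 : a < 1) {y : ℝ} (hy : 0 ≤ y) :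
    |Gamma a * exp (-y) - expConv a y| ≤ Gamma a + (1 + 1 / a) := by
  have hG := Gamma_pos_of_pos ha
  have h1 : exp (-y) ≤ 1 := exp_le_one_iff.2 (by linarith)
  have h2 := exp_pos (-y)
  have h3 := expConv_nonneg (a := a) hy
  have h4 := expConv_le_const ha ha1 hy
  have h5 : 0 < 1 / a := by positivity
  rw [abs_le]
  constructor <;> nlinarith

/-- The difference between the finite-horizon integrand and its limit is controlled by terms whose
integrals are `O(T ^ (a - 1))`. -/
theorem abs_integrand_sub_le (ha : 0 < a) (ha1 : a < 1) {T y : ℝ} (hT : 1 ≤ T) (hy : 0 < y)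
    (hyT : y < T) :
    |(-(expTail a y - expConv a y) +
          T ^ (a - 1) * (exp (-y) - exp (-(T - y))) + exp (-(T - y)) * expTail a T) *
        ((1 - exp (-T)) * (T - y) ^ (a - 1) - (Gamma a * exp (-y) - expConv a y) +
          exp (-T) * expTail a (T - y)) -
      (expTail a y - expConv a y) * (Gamma a * exp (-y) - expConv a y)| ≤
    T ^ (a - 1) * (exp (-y) * (T - y) ^ (a - 1) + exp (-(T - y)) * (T - y) ^ (a - 1) +
      (Gamma a + (1 + 1 / a) + Gamma a) * (exp (-y) + exp (-(T - y)))) +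
    (|expTail a y - expConv a y| * (T - y) ^ (a - 1) +
      Gamma a * T ^ (a - 1) * |expTail a y - expConv a y|) := by
  have hT0 : 0 < T := by linarith
  have hM := abs_Gamma_mul_exp_sub_expConv_le ha ha1 hy.le
  have hG := Gamma_pos_of_pos ha
  set M := Gamma a * exp (-y) - expConv a y
  set G := expTail a y - expConv a y
  have hp : 0 < T ^ (a - 1) := rpow_pos_of_pos hT0 _
  have hq : 0 < (T - y) ^ (a - 1) := rpow_pos_of_pos (by linarith) _
  have hAT := expTail_nonneg (a := a) hT0.le
  have hAT' := expTail_le_rpow ha ha1 hT0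
  have hAy := expTail_nonneg (a := a) (show 0 ≤ T - y by linarith)
  have hAy' := expTail_le_Gamma ha ha1 (show 0 ≤ T - y by linarith)
  have hx1 := exp_pos (-y)
  have hx2 := exp_pos (-(T - y))
  have hx3 := exp_pos (-T)
  have hx4 : exp (-T) ≤ 1 := exp_le_one_iff.2 (by linarith)
  have hx5 : exp (-T) ≤ T ^ (a - 1) := by
    have h1 : T ^ (-1 : ℝ) ≤ T ^ (a - 1) := rpow_le_rpow_of_exponent_le hT (by linarith)
    have h2 : exp (-T) ≤ T ^ (-1 : ℝ) := by
      rw [rpow_neg_one, ← one_div, le_div_iff₀ hT0, mul_comm]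
      exact mul_exp_neg_le_one T
    exact h2.trans h1
  set e₁ := T ^ (a - 1) * (exp (-y) - exp (-(T - y))) + exp (-(T - y)) * expTail a T with he₁
  set e₂ := (1 - exp (-T)) * (T - y) ^ (a - 1) + exp (-T) * expTail a (T - y) with he₂
  have h₁ : |e₁| ≤ T ^ (a - 1) * (exp (-y) + exp (-(T - y))) := by
    rw [abs_le, he₁]
    constructor <;> nlinarith [mul_pos hp hx1, mul_pos hp hx2, mul_nonneg hx2.le hAT,
      mul_le_mul_of_nonneg_left hAT' hx2.le]
  have h₂0 : 0 ≤ e₂ := add_nonneg (mul_nonneg (by linarith) hq.le) (mul_nonneg hx3.le hAy)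
  have h₂ : e₂ ≤ (T - y) ^ (a - 1) + exp (-T) * Gamma a := by
    have := mul_le_mul_of_nonneg_left hAy' hx3.le
    have := mul_pos hx3 hq
    rw [he₂]
    linarith
  have h₃ : |-M + e₂| ≤ (T - y) ^ (a - 1) + (Gamma a + (1 + 1 / a) + Gamma a) := by
    calc |-M + e₂| ≤ |-M| + |e₂| := abs_add_le _ _
      _ ≤ _ := by
        rw [abs_neg, abs_of_nonneg h₂0]
        nlinarith
  have h₄ : |e₂| ≤ (T - y) ^ (a - 1) + Gamma a * T ^ (a - 1) := by
    rw [abs_of_nonneg h₂0]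
    nlinarith
  have key : (-G + T ^ (a - 1) * (exp (-y) - exp (-(T - y))) + exp (-(T - y)) * expTail a T) *
      ((1 - exp (-T)) * (T - y) ^ (a - 1) - M + exp (-T) * expTail a (T - y)) - G * M =
      e₁ * (-M + e₂) - G * e₂ := by
    rw [he₁, he₂]; ring
  rw [key]
  calc |e₁ * (-M + e₂) - G * e₂| ≤ |e₁| * |-M + e₂| + |G| * |e₂| := by
        rw [← abs_mul, ← abs_mul]; exact abs_sub _ _
    _ ≤ T ^ (a - 1) * (exp (-y) + exp (-(T - y))) *
          ((T - y) ^ (a - 1) + (Gamma a + (1 + 1 / a) + Gamma a)) +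
        |G| * ((T - y) ^ (a - 1) + Gamma a * T ^ (a - 1)) := by gcongr
    _ = _ := by ring

theorem abs_triple_integral_sub_le (ha : 0 < a) (ha1 : a < 1) :
    ∃ C : ℝ, ∀ T : ℝ, 1 ≤ T →
      |(∫ t1 in (0:ℝ)..T, ∫ t2 in (0:ℝ)..T, ∫ s in (0:ℝ)..T,
        exp (t1 - T - |s - t2|) * Real.sign (t2 - s) *
          (T ^ (a - 1) - (T - s) ^ (a - 1)) *
          (t2 ^ (a - 1) - Real.sign (t2 - t1) * |t2 - t1| ^ (a - 1))) -
        (Gamma a ^ 2 * (a - 1 / 2) +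
          Gamma a * Gamma (2 - 2 * a) * Gamma (2 * a) / Gamma (1 - a))| ≤ C * T ^ (a - 1) := by
  obtain ⟨hL, hL'⟩ := integral_expTail_sub_expConv_mul ha ha1
  have hG := Gamma_pos_of_pos ha
  have hGi := integrableOn_expTail_sub_expConv ha ha1
  set c := Gamma a + (1 + 1 / a) + Gamma a with hc
  set N := ∫ y in Set.Ioi 0, |expTail a y - expConv a y| with hN
  refine ⟨((1 + 1 / a) + Gamma a + c * 2) + ((N + (Gamma a + (2 + 2 / a)) / a) + Gamma a * N) +
    (2 + 2 / a) * (Gamma a + (1 + 1 / a)) / (1 - a), fun T hT => ?_⟩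
  have hT0 : 0 < T := by linarith
  have hp : 0 < T ^ (a - 1) := rpow_pos_of_pos hT0 _
  have hIoo : ∀ f : ℝ → ℝ, ∫ t in Set.Ioo 0 T, f t = ∫ t in (0:ℝ)..T, f t := fun f => by
    rw [intervalIntegral.integral_of_le hT0.le, integral_Ioc_eq_integral_Ioo]
  have hiff := fun f : ℝ → ℝ =>
    intervalIntegrable_iff_integrableOn_Ioo_of_le (f := f) (μ := volume) hT0.le
  rw [triple_integral_eq ha ha1 hT0, ← hL']
  set G : ℝ → ℝ := fun y => expTail a y - expConv a y with hGdef
  set M : ℝ → ℝ := fun y => Gamma a * exp (-y) - expConv a y with hMdef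
  set P : ℝ → ℝ := fun y => (-(expTail a y - expConv a y) +
          T ^ (a - 1) * (exp (-y) - exp (-(T - y))) + exp (-(T - y)) * expTail a T) *
        ((1 - exp (-T)) * (T - y) ^ (a - 1) - (Gamma a * exp (-y) - expConv a y) +
          exp (-T) * expTail a (T - y)) with hPdef
  have b1 : IntegrableOn (fun y => exp (-y) * (T - y) ^ (a - 1)) (Set.Ioo 0 T) :=
    (hiff _).1 (intervalIntegrable_exp_neg_mul_sub_rpow ha T)
  have b2' : IntervalIntegrable (fun v => exp (-v) * v ^ (a - 1)) volume 0 T :=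
    (intervalIntegral.intervalIntegrable_rpow' (by linarith)).continuousOn_mul (by fun_prop)
  have b2 : IntegrableOn (fun y => exp (-(T - y)) * (T - y) ^ (a - 1)) (Set.Ioo 0 T) := by
    have h := (b2'.comp_sub_left T).symm
    rw [sub_self, sub_zero] at h
    exact (hiff _).1 h
  have b3 : IntegrableOn (fun y => exp (-y)) (Set.Ioo 0 T) :=
    (integrableOn_exp_neg_Ioi 0).mono_set Set.Ioo_subset_Ioi_self
  have b4 : IntegrableOn (fun y => exp (-(T - y))) (Set.Ioo 0 T) :=
    (hiff _).1 ((by fun_prop : Continuous fun y : ℝ => exp (-(T - y))).intervalIntegrable _ _)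
  obtain ⟨b5', v5⟩ := integral_mul_sub_rpow_le ha (f := fun y => |G y|) hGi.abs
    (fun _ _ => abs_nonneg _) (fun y hy => mul_abs_expTail_sub_expConv_le ha ha1 hy) hT0
  have b5 := (hiff _).1 b5'
  have hGabs : IntegrableOn (fun y => |G y|) (Set.Ioi 0) := hGi.abs
  have b6 : IntegrableOn (fun y => |G y|) (Set.Ioo 0 T) :=
    hGabs.mono_set Set.Ioo_subset_Ioi_self
  have v1 : ∫ y in Set.Ioo 0 T, exp (-y) * (T - y) ^ (a - 1) ≤ 1 + 1 / a := by
    rw [hIoo, ← expConv_eq]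
    exact expConv_le_const ha ha1 hT0.le
  have v2 : ∫ y in Set.Ioo 0 T, exp (-(T - y)) * (T - y) ^ (a - 1) ≤ Gamma a := by
    rw [hIoo, intervalIntegral.integral_comp_sub_left (fun v => exp (-v) * v ^ (a - 1)) T,
      sub_self, sub_zero, integral_zero_exp_neg_mul_rpow ha hT0.le]
    have := mul_nonneg (exp_pos (-T)).le (expTail_nonneg (a := a) hT0.le)
    linarith
  have v3 : ∫ y in Set.Ioo 0 T, exp (-y) ≤ 1 := by
    rw [hIoo, integral_exp_neg_zero]
    linarith [exp_pos (-T)]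
  have v4 : ∫ y in Set.Ioo 0 T, exp (-(T - y)) ≤ 1 := by
    rw [hIoo, intervalIntegral.integral_comp_sub_left (fun v => exp (-v)) T,
      sub_self, sub_zero, integral_exp_neg_zero]
    linarith [exp_pos (-T)]
  have v6 : ∫ y in Set.Ioo 0 T, |G y| ≤ N := by
    refine setIntegral_mono_set hGi.abs (ae_of_all _ fun _ => abs_nonneg _) ?_
    exact Set.Ioo_subset_Ioi_self.eventuallyLE
  rw [← hIoo] at v5
  have b34 : IntegrableOn (fun y => c * (exp (-y) + exp (-(T - y)))) (Set.Ioo 0 T) :=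
    (b3.add b4).const_mul c
  have b12 : IntegrableOn (fun y => exp (-y) * (T - y) ^ (a - 1) +
      exp (-(T - y)) * (T - y) ^ (a - 1)) (Set.Ioo 0 T) := b1.add b2
  have bL : IntegrableOn (fun y => T ^ (a - 1) *
      (exp (-y) * (T - y) ^ (a - 1) + exp (-(T - y)) * (T - y) ^ (a - 1) +
      c * (exp (-y) + exp (-(T - y))))) (Set.Ioo 0 T) := (b12.add b34).const_mul _
  have bR : IntegrableOn (fun y => |G y| * (T - y) ^ (a - 1) +
      Gamma a * T ^ (a - 1) * |G y|) (Set.Ioo 0 T) := b5.add (b6.const_mul _)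
  have hLR : IntegrableOn (fun y => T ^ (a - 1) *
      (exp (-y) * (T - y) ^ (a - 1) + exp (-(T - y)) * (T - y) ^ (a - 1) +
      c * (exp (-y) + exp (-(T - y)))) +
      (|G y| * (T - y) ^ (a - 1) + Gamma a * T ^ (a - 1) * |G y|)) (Set.Ioo 0 T) := bL.add bR
  have hbound : ∀ y ∈ Set.Ioo 0 T, ‖P y - G y * M y‖ ≤ T ^ (a - 1) *
      (exp (-y) * (T - y) ^ (a - 1) + exp (-(T - y)) * (T - y) ^ (a - 1) +
      c * (exp (-y) + exp (-(T - y)))) +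
    (|G y| * (T - y) ^ (a - 1) + Gamma a * T ^ (a - 1) * |G y|) := fun y hy =>
    abs_integrand_sub_le ha ha1 hT hy.1 hy.2
  have hbound' := (ae_restrict_iff' (μ := volume) measurableSet_Ioo).2 (ae_of_all _ hbound)
  have hGM : IntegrableOn (fun y => G y * M y) (Set.Ioo 0 T) :=
    hL.mono_set Set.Ioo_subset_Ioi_self
  have hPm : AEStronglyMeasurable P (volume.restrict (Set.Ioo 0 T)) := by
    refine ContinuousOn.aestronglyMeasurable ?_ measurableSet_Ioo
    have hA := (continuousOn_expTail ha).mono (Set.Ioo_subset_Ioi_self : Set.Ioo 0 T ⊆ _)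
    have hB := (continuousOn_expConv ha).mono (Set.Ioo_subset_Ioi_self : Set.Ioo 0 T ⊆ _)
    have hA' : ContinuousOn (fun y => expTail a (T - y)) (Set.Ioo 0 T) :=
      (continuousOn_expTail ha).comp (by fun_prop) fun y hy => sub_pos.2 hy.2
    have hr : ContinuousOn (fun y => (T - y) ^ (a - 1)) (Set.Ioo 0 T) :=
      ContinuousOn.rpow_const (by fun_prop) fun y hy => Or.inl (sub_pos.2 hy.2).ne'
    fun_prop
  have hdiff : IntegrableOn (fun y => P y - G y * M y) (Set.Ioo 0 T) :=
    Integrable.mono' hLR (hPm.sub hGM.aestronglyMeasurable) hbound'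
  have hP : IntegrableOn P (Set.Ioo 0 T) :=
    (hdiff.add hGM).congr (ae_of_all _ fun y => by simp)
  have hmain : |∫ y in Set.Ioo 0 T, (P y - G y * M y)| ≤
      (((1 + 1 / a) + Gamma a + c * 2) +
        ((N + (Gamma a + (2 + 2 / a)) / a) + Gamma a * N)) * T ^ (a - 1) := by
    refine (norm_integral_le_of_norm_le hLR hbound').trans ?_
    rw [integral_add bL bR, integral_const_mul, integral_add b12 b34, integral_add b1 b2,
      integral_const_mul, integral_add b3 b4, integral_add b5 (b6.const_mul _),
      integral_const_mul]
    have hc0 : 0 < c := by positivity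
    calc _ ≤ T ^ (a - 1) * ((1 + 1 / a) + Gamma a + c * (1 + 1)) +
          ((N + (Gamma a + (2 + 2 / a)) / a) * T ^ (a - 1) + Gamma a * T ^ (a - 1) * N) := by
          gcongr
      _ = _ := by ring
  have htail : |∫ y in Set.Ioi T, G y * M y| ≤
      (2 + 2 / a) * (Gamma a + (1 + 1 / a)) / (1 - a) * T ^ (a - 1) := by
    have hi := (integrableOn_Ioi_rpow_of_lt (show a - 2 < -1 by linarith) hT0).const_mul
      ((2 + 2 / a) * (Gamma a + (1 + 1 / a)))
    rw [← Real.norm_eq_abs]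
    refine (norm_integral_le_of_norm_le hi ?_).trans_eq ?_
    · refine (ae_restrict_iff' measurableSet_Ioi).2 (ae_of_all _ fun y hy => ?_)
      have hy0 : 0 < y := hT0.trans hy
      rw [norm_mul]
      calc _ ≤ ((2 + 2 / a) * y ^ (a - 2)) * (Gamma a + (1 + 1 / a)) :=
            mul_le_mul (abs_expTail_sub_expConv_le ha ha1 hy0)
              (abs_Gamma_mul_exp_sub_expConv_le ha ha1 hy0.le) (abs_nonneg _) (by positivity)
        _ = _ := by ring
    · rw [integral_const_mul, integral_Ioi_rpow_of_lt (by linarith) hT0,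
        show a - 2 + 1 = a - 1 by ring, ← neg_sub 1 a, neg_div_neg_eq]
      ring
  have hsplit : ∫ y in Set.Ioi 0, G y * M y =
      (∫ y in Set.Ioo 0 T, G y * M y) + ∫ y in Set.Ioi T, G y * M y := by
    rw [hIoo, ← intervalIntegral.integral_Ioi_sub_Ioi hL hT0.le]
    ring
  have hfin : (∫ y in Set.Ioo 0 T, P y) - ∫ y in Set.Ioi 0, G y * M y =
      (∫ y in Set.Ioo 0 T, (P y - G y * M y)) - ∫ y in Set.Ioi T, G y * M y := by
    rw [hsplit, integral_sub hP hGM]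
    ring
  rw [hfin]
  refine (abs_sub _ _).trans ((add_le_add hmain htail).trans_eq ?_)
  ring

end

theorem stmt_9 (H : ℝ) (hH : H ∈ Set.Ioo (0:ℝ) (1/2))
    (σsq : ℝ)
    (hσ : σsq = (4 * H - 1) + 2 * Real.Gamma (2 - 4 * H) * Real.Gamma (4 * H) /
        (Real.Gamma (2 * H) * Real.Gamma (1 - 2 * H)))
    (I11 : ℝ → ℝ)
    (hI11 : ∀ T : ℝ, I11 T =
      ∫ t1 in (0:ℝ)..T, ∫ t2 in (0:ℝ)..T, ∫ s in (0:ℝ)..T,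
        Real.exp (t1 - T - |s - t2|) * Real.sign (t2 - s) *
          (T ^ (2 * H - 1) - (T - s) ^ (2 * H - 1)) *
          (t2 ^ (2 * H - 1) - Real.sign (t2 - t1) * |t2 - t1| ^ (2 * H - 1))) :
    ∃ C : ℝ, ∀ᶠ T : ℝ in atTop,
      T ^ (1 - 2 * H) * |I11 T - Real.Gamma (2 * H) ^ 2 * σsq / 2| ≤ C := by
  have ha : 0 < 2 * H := by linarith [hH.1]
  have ha1 : 2 * H < 1 := by linarith [hH.2]
  obtain ⟨C, hC⟩ := abs_triple_integral_sub_le ha ha1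
  have hval : Gamma (2 * H) ^ 2 * σsq / 2 = Gamma (2 * H) ^ 2 * (2 * H - 1 / 2) +
      Gamma (2 * H) * Gamma (2 - 2 * (2 * H)) * Gamma (2 * (2 * H)) / Gamma (1 - 2 * H) := by
    have h1 := (Gamma_pos_of_pos ha).ne'
    have h2 := (Gamma_pos_of_pos (show 0 < 1 - 2 * H by linarith)).ne'
    rw [hσ, show 2 * (2 * H) = 4 * H by ring]
    field_simp
    ring
  refine ⟨C, ?_⟩
  filter_upwards [eventually_ge_atTop 1] with T hT
  have hT0 : 0 < T := by linarith
  rw [hI11, hval]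
  calc _ ≤ T ^ (1 - 2 * H) * (C * T ^ (2 * H - 1)) :=
        mul_le_mul_of_nonneg_left (hC T hT) (rpow_nonneg hT0.le _)
    _ = C := by
        rw [mul_left_comm, ← rpow_add hT0]
        simp
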